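/- arXiv:0905.4192 — 2 statements merged into one kernel-verified Lean document; each statement's English description precedes it below -/
import Mathlib

section
/- Let (X, d) be a metric space and let U¹, U², V¹, V² ⊆ X be nonempty subsets, each of positive diameter, such that d(U¹, U²) ≥ 2·min{diam(U¹), diam(U²)} and d(V¹, V²) ≥ 2·min{diam(V¹), diam(V²)}. Then there exist indices i, j ∈ {1, 2} such that d(Uⁱ, Vʲ) > 0. -/
open Metric

/-- The distance between two subsets of a metric space:
`d(A,B) = inf { dist x y : x ∈ A, y ∈ B }`. -/
noncomputable def setDist {X : Type*} [MetricSpace X] (A B : Set X) : ℝ :=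
  sInf {d : ℝ | ∃ x ∈ A, ∃ y ∈ B, d = dist x y}

theorem setDist_comm_aux {X : Type*} [MetricSpace X] (A B : Set X) :
    setDist A B = setDist B A := by
  unfold setDist
  congr 1
  ext d
  constructor
  · rintro ⟨x, hx, y, hy, h⟩
    exact ⟨y, hy, x, hx, by rw [h, dist_comm]⟩
  · rintro ⟨x, hx, y, hy, h⟩
    exact ⟨y, hy, x, hx, by rw [h, dist_comm]⟩

theorem setDist_near_aux {X : Type*} [MetricSpace X] {A B : Set X} (hA : A.Nonempty)
    (hB : B.Nonempty) (h : setDist A B ≤ 0) {e : ℝ} (he : 0 < e) :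
    ∃ x ∈ A, ∃ y ∈ B, dist x y < e := by
  obtain ⟨a, ha⟩ := hA
  obtain ⟨b, hb⟩ := hB
  obtain ⟨d, ⟨x, hx, y, hy, hd⟩, hlt⟩ :=
    exists_lt_of_csInf_lt (s := {d : ℝ | ∃ x ∈ A, ∃ y ∈ B, d = dist x y})
      ⟨_, a, ha, b, hb, rfl⟩ (lt_of_le_of_lt h he)
  exact ⟨x, hx, y, hy, hd ▸ hlt⟩

theorem setDist_le_diam_aux {X : Type*} [MetricSpace X] {A B C : Set X} (hA : A.Nonempty)
    (hB : B.Nonempty) (hC : C.Nonempty) (hd : 0 < diam A)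
    (h1 : setDist A B ≤ 0) (h2 : setDist A C ≤ 0) : setDist B C ≤ diam A := by
  have hbd : Bornology.IsBounded A := by
    by_contra hn
    rw [diam_eq_zero_of_unbounded hn] at hd
    exact lt_irrefl _ hd
  refine le_of_forall_pos_le_add fun e he => ?_
  obtain ⟨x, hx, y, hy, hxy⟩ := setDist_near_aux hA hB h1 (half_pos he)
  obtain ⟨z, hz, w, hw, hzw⟩ := setDist_near_aux hA hC h2 (half_pos he)
  have h3 : setDist B C ≤ dist y w := by
    refine csInf_le ⟨0, ?_⟩ ⟨y, hy, w, hw, rfl⟩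
    rintro _ ⟨p, _, q, _, rfl⟩
    exact dist_nonneg
  have h4 := dist_le_diam_of_mem hbd hx hz
  have h5 := dist_triangle4 y x z w
  rw [dist_comm y x] at h5
  linarith

/-- If `U¹, U², V¹, V²` are nonempty sets of positive diameter with
`d(U¹,U²) ≥ 2 min(diam U¹, diam U²)` and `d(V¹,V²) ≥ 2 min(diam V¹, diam V²)`,
then there are indices `i, j` with `d(Uⁱ, Vʲ) > 0`. -/
theorem stmt0 {X : Type*} [MetricSpace X] (U V : Fin 2 → Set X)
    (hUne : ∀ i, (U i).Nonempty) (hVne : ∀ i, (V i).Nonempty)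
    (hUdiam : ∀ i, 0 < diam (U i)) (hVdiam : ∀ i, 0 < diam (V i))
    (hU : setDist (U 0) (U 1) ≥ 2 * min (diam (U 0)) (diam (U 1)))
    (hV : setDist (V 0) (V 1) ≥ 2 * min (diam (V 0)) (diam (V 1))) :
    ∃ i j : Fin 2, 0 < setDist (U i) (V j) := by
  by_contra! hn
  have a : ∀ i, setDist (V 0) (V 1) ≤ diam (U i) := fun i =>
    setDist_le_diam_aux (hUne i) (hVne 0) (hVne 1) (hUdiam i) (hn i 0) (hn i 1)
  have b : ∀ j, setDist (U 0) (U 1) ≤ diam (V j) := fun j =>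
    setDist_le_diam_aux (hVne j) (hUne 0) (hUne 1) (hVdiam j)
      (setDist_comm_aux (V j) (U 0) ▸ hn 0 j) (setDist_comm_aux (V j) (U 1) ▸ hn 1 j)
  have h1 := le_min (a 0) (a 1)
  have h2 := le_min (b 0) (b 1)
  have h3 := lt_min (hUdiam 0) (hUdiam 1)
  have h4 := lt_min (hVdiam 0) (hVdiam 1)
  linarith
end

section
/- Let K ⊆ ℝ be a compact set and let η : K → ℝ satisfy η(t) > 0 for every t ∈ K. Then there exist finitely many points t₁ < t₂ < ⋯ < t_m in K and radii η₁, …, η_m with 0 < ηᵢ < η(tᵢ) for each i, such that K ⊆ ⋃ᵢ (tᵢ − ηᵢ, tᵢ + ηᵢ) and tᵢ + ηᵢ ≤ t_{i+2} − η_{i+2} for every i ≤ m − 2. In particular, the intervals (tᵢ − ηᵢ, tᵢ + ηᵢ) and (t_{i+2} − η_{i+2}, t_{i+2} + η_{i+2}) are disjoint, and every point of ℝ belongs to at most two of the intervals (tᵢ − ηᵢ, tᵢ + ηᵢ). -/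
open Set

/-- The interval-covering step of the Almgren–Pitts combinatorial argument:
a compact `K ⊆ ℝ` with a pointwise positive radius function `η` can be covered
by finitely many intervals `(tᵢ - ηᵢ, tᵢ + ηᵢ)` centered at points `tᵢ ∈ K`
with `0 < ηᵢ < η(tᵢ)`, such that `tᵢ + ηᵢ ≤ t_{i+2} - η_{i+2}`; in particular
intervals whose indices differ by two are disjoint and every real number lies
in at most two of the intervals. -/
theorem stmt2 (K : Set ℝ) (hK : IsCompact K) (η : ℝ → ℝ) (hη : ∀ t ∈ K, 0 < η t) :
    ∃ (m : ℕ) (t r : Fin m → ℝ),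
      (∀ i, t i ∈ K) ∧ StrictMono t ∧
      (∀ i, 0 < r i ∧ r i < η (t i)) ∧
      K ⊆ ⋃ i, Ioo (t i - r i) (t i + r i) ∧
      (∀ (i : Fin m) (h : (i : ℕ) + 2 < m),
        t i + r i ≤ t ⟨(i : ℕ) + 2, h⟩ - r ⟨(i : ℕ) + 2, h⟩) ∧
      (∀ (i : Fin m) (h : (i : ℕ) + 2 < m),
        Disjoint (Ioo (t i - r i) (t i + r i))
          (Ioo (t ⟨(i : ℕ) + 2, h⟩ - r ⟨(i : ℕ) + 2, h⟩)
               (t ⟨(i : ℕ) + 2, h⟩ + r ⟨(i : ℕ) + 2, h⟩))) ∧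
      (∀ x : ℝ, ∀ i j k : Fin m,
        x ∈ Ioo (t i - r i) (t i + r i) → x ∈ Ioo (t j - r j) (t j + r j) →
        x ∈ Ioo (t k - r k) (t k + r k) → i = j ∨ i = k ∨ j = k) := by
  classical
  obtain ⟨s0, hs0⟩ : ∃ s : Finset ℝ, (∀ x ∈ s, x ∈ K) ∧
      ∀ y ∈ K, ∃ x ∈ s, y ∈ Ioo (x - η x / 2) (x + η x / 2) := by
    obtain ⟨s, hs, hc⟩ := hK.elim_nhds_subcover (fun x => Ioo (x - η x / 2) (x + η x / 2))
      (fun x hx => Ioo_mem_nhds (by linarith [hη x hx]) (by linarith [hη x hx]))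
    refine ⟨s, hs, fun y hy => ?_⟩
    simpa only [mem_iUnion, exists_prop] using hc hy
  obtain ⟨s, ⟨hsK, hsc⟩, hmin⟩ := exists_minimal_of_wellFoundedLT
    (fun s : Finset ℝ => (∀ x ∈ s, x ∈ K) ∧
      ∀ y ∈ K, ∃ x ∈ s, y ∈ Ioo (x - η x / 2) (x + η x / 2)) ⟨s0, hs0⟩
  -- every chosen interval has a private point
  have hpriv : ∀ v ∈ s, ∃ y, y ∈ Ioo (v - η v / 2) (v + η v / 2) ∧
      ∀ u ∈ s, u ≠ v → y ∉ Ioo (u - η u / 2) (u + η u / 2) := by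
    intro v hv
    by_contra! hcon
    have h1 := @hmin (s.erase v) ⟨fun x hx => hsK x (Finset.mem_of_mem_erase hx), ?_⟩
      (Finset.erase_subset v s)
    · exact Finset.notMem_erase v s (h1 hv)
    · intro y hy
      obtain ⟨x, hx, hyx⟩ := hsc y hy
      by_cases hxv : x = v
      · subst hxv
        obtain ⟨u, hu, huv, hyu⟩ := hcon y hyx
        exact ⟨u, Finset.mem_erase.2 ⟨huv, hu⟩, hyu⟩
      · exact ⟨x, Finset.mem_erase.2 ⟨hxv, hx⟩, hyx⟩
  have key : ∀ p ∈ s, ∀ q ∈ s, ∀ w ∈ s, p < q → q < w →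
      p + η p / 2 ≤ w - η w / 2 := by
    intro p hp q hq w hw hpq hqw
    by_contra! hlt
    obtain ⟨x, ⟨hx1, hx2⟩, hx⟩ := hpriv p hp
    obtain ⟨y, ⟨hy1, hy2⟩, hy⟩ := hpriv q hq
    obtain ⟨z, ⟨hz1, hz2⟩, hz⟩ := hpriv w hw
    have a := hx q hq hpq.ne'
    have b := hy p hp hpq.ne
    have c := hy w hw hqw.ne'
    have d := hz q hq hqw.ne
    simp only [mem_Ioo, not_and_or, not_lt] at a b c d
    rcases b with b | b
    · rcases a with a | a <;> linarith
    · rcases c with c | c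
      · linarith
      · rcases d with d | d <;> linarith
  have key' : ∀ i j k : Fin s.card, i < j → j < k →
      s.orderEmbOfFin rfl i + η (s.orderEmbOfFin rfl i) / 2 ≤
        s.orderEmbOfFin rfl k - η (s.orderEmbOfFin rfl k) / 2 := fun i j k hij hjk =>
    key _ (s.orderEmbOfFin_mem rfl i) _ (s.orderEmbOfFin_mem rfl j) _ (s.orderEmbOfFin_mem rfl k)
      ((s.orderEmbOfFin rfl).strictMono hij) ((s.orderEmbOfFin rfl).strictMono hjk)
  have key2 : ∀ (i : Fin s.card) (h : (i : ℕ) + 2 < s.card),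
      s.orderEmbOfFin rfl i + η (s.orderEmbOfFin rfl i) / 2 ≤
        s.orderEmbOfFin rfl ⟨(i : ℕ) + 2, h⟩ - η (s.orderEmbOfFin rfl ⟨(i : ℕ) + 2, h⟩) / 2 :=
    fun i h => key' i ⟨(i : ℕ) + 1, by omega⟩ _ (by simp [Fin.lt_def]) (by simp [Fin.lt_def])
  refine ⟨s.card, s.orderEmbOfFin rfl, fun i => η (s.orderEmbOfFin rfl i) / 2,
    fun i => hsK _ (s.orderEmbOfFin_mem rfl i), (s.orderEmbOfFin rfl).strictMono, ?_, ?_,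
    key2, ?_, ?_⟩
  · intro i
    have := hη _ (hsK _ (s.orderEmbOfFin_mem rfl i))
    constructor <;> linarith
  · intro y hy
    obtain ⟨x, hx, hyx⟩ := hsc y hy
    have : x ∈ Set.range (s.orderEmbOfFin rfl) := by
      rw [Finset.range_orderEmbOfFin]; exact hx
    obtain ⟨i, rfl⟩ := this
    exact mem_iUnion.2 ⟨i, hyx⟩
  · intro i h
    rw [Set.disjoint_left]
    intro x hx hx'
    linarith [key2 i h, hx.2, hx'.1]
  · intro x i j k hi hj hk
    have no : ∀ a b c : Fin s.card, a < b → b < c →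
        x < s.orderEmbOfFin rfl a + η (s.orderEmbOfFin rfl a) / 2 →
        s.orderEmbOfFin rfl c - η (s.orderEmbOfFin rfl c) / 2 < x → False :=
      fun a b c hab hbc h1 h2 => by linarith [key' a b c hab hbc]
    by_contra! hne
    obtain ⟨hij, hik, hjk⟩ := hne
    rcases lt_or_gt_of_ne hij with h1 | h1 <;> rcases lt_or_gt_of_ne hik with h2 | h2 <;>
      rcases lt_or_gt_of_ne hjk with h3 | h3
    · exact no i j k h1 h3 hi.2 hk.1
    · exact no i k j h2 h3 hi.2 hj.1
    · exact absurd (h1.trans h3) h2.not_gt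
    · exact no k i j h2 h1 hk.2 hj.1
    · exact no j i k h1 h2 hj.2 hk.1
    · exact absurd (h2.trans h3) h1.not_gt
    · exact no j k i h3 h2 hj.2 hi.1
    · exact no k j i h3 h1 hk.2 hi.1
end
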